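/- arXiv:1909.13023 — 2 statements merged into one kernel-verified Lean document; each statement's English description precedes it below -/
import Mathlib

section
/- Let f : ℝ → ℝ be infinitely differentiable, x ∈ ℝ with f′(x) ≠ 0, and let d₀ = 1/10, d₁ = 6/10, d₂ = 3/10. Define, for small h > 0, the WENO-LOC unnormalized weights αₖ(h) = dₖ/βₖ(h)² (with the WENO-LOC smoothness indicators βₖ(h), which are nonzero for all sufficiently small h) and the normalized weights ωₖ(h) = αₖ(h)/(α₀(h)+α₁(h)+α₂(h)). Then for each k ∈ {0,1,2}, ωₖ(h) − dₖ = O(h) as h → 0⁺; that is, the WENO-LOC nonlinear weights converge to the linear weights with only first order of accuracy. -/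
open Filter Asymptotics Topology

/-- The WENO-LOC smoothness indicators of `f` at center `x` with mesh size `h`. -/
noncomputable def betaLOC (f : ℝ → ℝ) (x h : ℝ) : Fin 3 → ℝ :=
  ![(1/2) * ((f (x - h) - f (x - 2*h))^2 + (f x - f (x - h))^2)
      + (f x - 2 * f (x - h) + f (x - 2*h))^2,
    (1/2) * ((f x - f (x - h))^2 + (f (x + h) - f x)^2)
      + (f (x - h) - 2 * f x + f (x + h))^2,
    (1/2) * ((f (x + h) - f x)^2 + (f (x + 2*h) - f (x + h))^2)
      + (f x - 2 * f (x + h) + f (x + 2*h))^2]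

/-- The linear (ideal) weights `d₀ = 1/10`, `d₁ = 6/10`, `d₂ = 3/10`. -/
noncomputable def dlin : Fin 3 → ℝ := ![1/10, 6/10, 3/10]

/-- The difference quotient of a smooth function, filled in at zero, is differentiable at zero. -/
theorem exists_quotient (f : ℝ → ℝ) (hf : ContDiff ℝ (⊤ : ℕ∞) f) (x : ℝ) :
    ∃ q : ℝ → ℝ, q 0 = deriv f x ∧ DifferentiableAt ℝ q 0 ∧ ∀ t, f (x + t) = f x + t * q t := by
  refine ⟨fun t => dslope f x (x + t), by simp, ?_, ?_⟩
  · have h := taylor_isLittleO (f := f) (x₀ := x) (n := 2) (s := Set.univ) convex_univ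
      (Set.mem_univ _) ((hf.of_le (WithTop.coe_le_coe.2 (le_top : ((2 : ℕ) : ℕ∞) ≤ ⊤))).contDiffOn)
    have hsub : Tendsto (fun t : ℝ => x + t) (𝓝 0) (𝓝 x) := by
      have : ContinuousAt (fun t : ℝ => x + t) 0 := by fun_prop
      simpa [ContinuousAt] using this
    rw [nhdsWithin_univ] at h
    have h2 := h.comp_tendsto hsub
    refine HasDerivAt.differentiableAt (f' := iteratedDeriv 2 f x / 2) ?_
    rw [hasDerivAt_iff_isLittleO, isLittleO_iff]
    intro c hc
    filter_upwards [isLittleO_iff.1 h2 hc] with t ht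
    rcases eq_or_ne t 0 with rfl | h0
    · simp
    · have e : dslope f x (x + t) = (f (x + t) - f x) / t := by
        rw [dslope_of_ne _ (by simpa using h0), slope_def_field]; simp
      simp only [taylorWithinEval_succ, taylor_within_zero_eval, Function.comp,
        iteratedDerivWithin_univ, add_sub_cancel_left] at ht
      simp only [e, add_zero, dslope_same, sub_zero, smul_eq_mul]
      have ht' : ‖(f (x + t) - f x) / t - deriv f x - t * (iteratedDeriv 2 f x / 2)‖ * ‖t‖
          ≤ c * ‖t‖ * ‖t‖ := by
        rw [← norm_mul]
        convert ht using 1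
        · congr 1
          simp [iteratedDeriv_one]
          field_simp
          ring
        · rw [norm_pow]; ring
      exact le_of_mul_le_mul_right ht' (norm_pos_iff.2 h0)
  · intro t
    have := sub_smul_dslope f x (x + t)
    simp only [add_sub_cancel_left, smul_eq_mul] at this
    linarith

/-- Scaled smoothness indicators. -/
theorem exists_scaled (f : ℝ → ℝ) (hf : ContDiff ℝ (⊤ : ℕ∞) f) (x : ℝ) :
    ∃ B : Fin 3 → ℝ → ℝ, ∀ k, B k 0 = deriv f x ^ 2 ∧ DifferentiableAt ℝ (B k) 0 ∧
      ∀ h, betaLOC f x h k = h ^ 2 * B k h := by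
  obtain ⟨q, q0, qd, hq⟩ := exists_quotient f hf x
  have hd : ∀ c : ℝ, DifferentiableAt ℝ (fun h => q (c * h)) 0 := fun c =>
    DifferentiableAt.comp (g := q) (f := fun h : ℝ => c * h) 0 (by simpa using qd) (by fun_prop)
  obtain ⟨u, hu⟩ : ∃ u : ℝ → ℝ, u = fun h => q (-1 * h) := ⟨_, rfl⟩
  obtain ⟨v, hv⟩ : ∃ v : ℝ → ℝ, v = fun h => q (-2 * h) := ⟨_, rfl⟩
  obtain ⟨w, hw⟩ : ∃ w : ℝ → ℝ, w = fun h => q (2 * h) := ⟨_, rfl⟩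
  have h1 : DifferentiableAt ℝ u 0 := hu ▸ hd (-1)
  have h2 : DifferentiableAt ℝ v 0 := hv ▸ hd (-2)
  have h3 : DifferentiableAt ℝ w 0 := hw ▸ hd 2
  have u0 : u 0 = deriv f x := by simp [hu, q0]
  have v0 : v 0 = deriv f x := by simp [hv, q0]
  have w0 : w 0 = deriv f x := by simp [hw, q0]
  refine ⟨![fun h => (1/2) * ((2 * v h - u h)^2 + (u h)^2)
      + (2 * u h - 2 * v h)^2,
    fun h => (1/2) * ((u h)^2 + (q h)^2) + (q h - u h)^2,
    fun h => (1/2) * ((q h)^2 + (2 * w h - q h)^2) + (2 * w h - 2 * q h)^2], ?_⟩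
  have e1 : ∀ h, f (x - h) = f x - h * q (-1 * h) := fun h => by
    have := hq (-1 * h)
    rw [show x + -1 * h = x - h by ring] at this
    rw [this]; ring
  have e2 : ∀ h, f (x - 2 * h) = f x - 2 * h * q (-2 * h) := fun h => by
    have := hq (-2 * h)
    rw [show x + -2 * h = x - 2 * h by ring] at this
    rw [this]; ring
  intro k
  fin_cases k
  · refine ⟨?_, ?_, ?_⟩
    · simp [q0, u0, v0, w0]; try ring
    · simp only [Fin.zero_eta, Matrix.cons_val_zero]; fun_prop
    · intro h
      simp only [betaLOC, Fin.zero_eta, Matrix.cons_val_zero, e1, e2, hu, hv]; ring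
  · refine ⟨?_, ?_, ?_⟩
    · simp [q0, u0, v0, w0]; try ring
    · simp only [Fin.mk_one, Matrix.cons_val_one, Matrix.cons_val_zero]; fun_prop
    · intro h
      simp only [betaLOC, Fin.mk_one, Matrix.cons_val_one, Matrix.cons_val_zero, e1, hq, hu]; ring
  · refine ⟨?_, ?_, ?_⟩
    · simp [q0, u0, v0, w0]; try ring
    · simp only [Fin.reduceFinMk, Matrix.cons_val]; fun_prop
    · intro h
      simp only [betaLOC, Fin.reduceFinMk, Matrix.cons_val, hq, hw]; ring

/-- The WENO-LOC nonlinear weights (with `p = 2`, `ε = 0`) converge to the linear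
weights with only first order of accuracy in smooth monotone regions. -/
theorem wenoLOC_weights_first_order (f : ℝ → ℝ) (hf : ContDiff ℝ (⊤ : ℕ∞) f) (x : ℝ)
    (hx : deriv f x ≠ 0)
    (hβ : ∀ k : Fin 3, ∀ᶠ h in 𝓝[>] (0:ℝ), betaLOC f x h k ≠ 0) :
    ∀ k : Fin 3,
      (fun h : ℝ =>
          (dlin k / (betaLOC f x h k)^2)
            / (∑ l : Fin 3, dlin l / (betaLOC f x h l)^2) - dlin k)
        =O[𝓝[>] (0:ℝ)] fun h => h := by
  obtain ⟨B, hB⟩ := exists_scaled f hf x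
  intro k
  have hsum : ∑ l : Fin 3, dlin l / (B l 0) ^ 2 = 1 / (deriv f x ^ 2) ^ 2 := by
    simp only [(hB _).1, ← Finset.sum_div]
    congr 1
    simp [dlin, Fin.sum_univ_three]; norm_num
  have hd : ∀ l, DifferentiableAt ℝ (fun h => dlin l / (B l h) ^ 2) 0 := fun l =>
    (differentiableAt_const _).div ((hB l).2.1.pow 2) (by rw [(hB l).1]; positivity)
  have hW : DifferentiableAt ℝ
      (fun h => (dlin k / (B k h) ^ 2) / ∑ l : Fin 3, dlin l / (B l h) ^ 2) 0 :=
    (hd k).div (DifferentiableAt.fun_sum fun l _ => hd l) (by rw [hsum]; positivity)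
  have hO := hW.isBigO_sub.mono (nhdsWithin_le_nhds (s := Set.Ioi 0))
  refine hO.congr' ?_ (by simp)
  filter_upwards [self_mem_nhdsWithin] with h hh
  have hh : h ≠ 0 := ne_of_gt hh
  rw [hsum, (hB k).1]
  congr 1
  · have e : ∀ l, dlin l / (betaLOC f x h l) ^ 2 = (dlin l / (B l h) ^ 2) / h ^ 4 := fun l => by
      rw [(hB l).2.2, div_div]; congr 1; ring
    simp only [e, ← Finset.sum_div]
    rw [div_div_div_cancel_right₀ (by positivity)]
  · field_simp
end

section
/- Let f : ℝ → ℝ be infinitely differentiable, x ∈ ℝ with f′(x) ≠ 0, and let d₀ = 1/10, d₁ = 6/10, d₂ = 3/10. Define, for small h > 0, the WENO-JS unnormalized weights αₖ(h) = dₖ/βₖ(h)² (with the WENO-JS smoothness indicators βₖ(h), which are nonzero for all sufficiently small h) and the normalized weights ωₖ(h) = αₖ(h)/(α₀(h)+α₁(h)+α₂(h)). Then for each k ∈ {0,1,2}, ωₖ(h) − dₖ = O(h²) as h → 0⁺; that is, the WENO-JS nonlinear weights converge to the linear weights with second order of accuracy. -/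
open Filter Asymptotics Topology

/-- The WENO-JS smoothness indicators of `f` at center `x` with mesh size `h`. -/
noncomputable def betaJS (f : ℝ → ℝ) (x h : ℝ) : Fin 3 → ℝ :=
  ![(13/12) * (f (x - 2*h) - 2 * f (x - h) + f x)^2
      + (1/4) * (f (x - 2*h) - 4 * f (x - h) + 3 * f x)^2,
    (13/12) * (f (x - h) - 2 * f x + f (x + h))^2
      + (1/4) * (f (x + h) - f (x - h))^2,
    (13/12) * (f x - 2 * f (x + h) + f (x + 2*h))^2
      + (1/4) * (3 * f x - 4 * f (x + h) + f (x + 2*h))^2]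

lemma taylor_aux (f : ℝ → ℝ) (hf : ContDiff ℝ (⊤ : ℕ∞) f) (x : ℝ) :
    ∃ b : ℝ, ∀ t : ℝ,
      (fun h : ℝ => f (x + t * h) - f x - deriv f x * t * h - b * t ^ 2 * h ^ 2)
        =O[𝓝[>] (0:ℝ)] fun h => h ^ 3 := by
  refine ⟨iteratedDeriv 2 f x / 2, fun t => ?_⟩
  have h3 : ContDiff ℝ (3 : ℕ) f := hf.of_le (WithTop.coe_le_coe.2 (le_top (a := ((3 : ℕ) : ℕ∞))))
  have T := taylor_isLittleO_univ (x₀ := x) h3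
  have ht : Tendsto (fun h : ℝ => x + t * h) (𝓝[>] 0) (𝓝 x) := by
    have : Continuous (fun h : ℝ => x + t * h) := by fun_prop
    have := this.tendsto 0
    simp only [mul_zero, add_zero] at this
    exact this.mono_left nhdsWithin_le_nhds
  have T2 := (T.comp_tendsto ht).isBigO
  have T3 : ((fun y : ℝ => (y - x) ^ 3) ∘ fun h : ℝ => x + t * h)
      =O[𝓝[>] (0:ℝ)] fun h => h ^ 3 := by
    have : ((fun y : ℝ => (y - x) ^ 3) ∘ fun h : ℝ => x + t * h) = fun h => t ^ 3 * h ^ 3 := by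
      funext h; simp only [Function.comp]; ring
    rw [this]
    exact (isBigO_refl _ _).const_mul_left _
  have T4 : (fun h : ℝ => (iteratedDeriv 3 f x / 6 * t ^ 3) * h ^ 3)
      =O[𝓝[>] (0:ℝ)] fun h => h ^ 3 := (isBigO_refl _ _).const_mul_left _
  refine ((T2.trans T3).add T4).congr_left fun h => ?_
  simp only [Function.comp, taylor_within_apply, Finset.sum_range_succ, Finset.sum_range_zero,
    iteratedDerivWithin_univ, iteratedDeriv_zero, iteratedDeriv_one, Nat.factorial, smul_eq_mul]
  push_cast
  ring

lemma div_aux {g : ℝ → ℝ} {n : ℕ} (hg : g =O[𝓝[>] (0:ℝ)] fun h => h ^ (n + 1)) :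
    (fun h => g h / h) =O[𝓝[>] (0:ℝ)] fun h => h ^ n := by
  have := hg.mul (isBigO_refl (fun h : ℝ => h⁻¹) (𝓝[>] (0:ℝ)))
  refine this.congr' (Eventually.of_forall fun h => (div_eq_mul_inv _ _).symm) ?_
  filter_upwards [self_mem_nhdsWithin] with h hh
  have : h ≠ 0 := ne_of_gt hh
  rw [pow_succ, mul_assoc, mul_inv_cancel₀ this, mul_one]

lemma pow_aux {m n : ℕ} (hmn : n ≤ m) :
    (fun h : ℝ => h ^ m) =O[𝓝[>] (0:ℝ)] fun h => h ^ n :=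
  (IsBigO.of_bound 1 (by
    filter_upwards [Ioo_mem_nhdsGT (zero_lt_one (α := ℝ))] with h hh
    rw [one_mul, Real.norm_eq_abs, Real.norm_eq_abs, abs_of_pos (pow_pos hh.1 _),
      abs_of_pos (pow_pos hh.1 _)]
    exact pow_le_pow_of_le_one hh.1.le hh.2.le hmn))

/-- Abstract expansion of a smoothness indicator. -/
lemma beta_aux {D E : ℝ → ℝ} {a c : ℝ} (hc : c ^ 2 = 4 * a ^ 2)
    (hD : D =O[𝓝[>] (0:ℝ)] fun h => h ^ 2)
    (hE : (fun h => E h - c * h) =O[𝓝[>] (0:ℝ)] fun h => h ^ 3) :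
    (fun h => ((13/12) * D h ^ 2 + (1/4) * E h ^ 2) / h ^ 2 - a ^ 2)
      =O[𝓝[>] (0:ℝ)] fun h => h ^ 2 := by
  have hu := (div_aux (n := 1) hD).pow 2
  have hv := div_aux (n := 2) hE
  have h1 : (fun h : ℝ => h ^ 2) =O[𝓝[>] (0:ℝ)] fun _ => (1:ℝ) := by
    simpa using pow_aux (m := 2) (n := 0) (by norm_num)
  have hv1 : (fun h => (E h - c * h) / h + 2 * c) =O[𝓝[>] (0:ℝ)] fun _ => (1:ℝ) :=
    (hv.trans h1).add (isBigO_const_const _ one_ne_zero _)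
  have hA := (hu.const_mul_left (13/12)).add
    (((hv.mul hv1).const_mul_left (1/4)).congr_right (g₂ := fun h : ℝ => (h ^ 1) ^ 2)
      (fun h => by ring))
  refine hA.congr' ?_ (Eventually.of_forall fun h => by ring)
  filter_upwards [self_mem_nhdsWithin] with h hh
  have : h ≠ 0 := ne_of_gt hh
  have ha : a ^ 2 = c ^ 2 / 4 := by linarith
  rw [ha]
  field_simp
  ring

lemma betaJS_aux (f : ℝ → ℝ) (hf : ContDiff ℝ (⊤ : ℕ∞) f) (x : ℝ) (k : Fin 3) :
    (fun h => betaJS f x h k / h ^ 2 - (deriv f x) ^ 2) =O[𝓝[>] (0:ℝ)] fun h => h ^ 2 := by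
  obtain ⟨b, hb⟩ := taylor_aux f hf x
  have p1 := hb 1
  have p2 := hb 2
  have m1 := hb (-1)
  have m2 := hb (-2)
  have h32 := pow_aux (m := 3) (n := 2) (by norm_num)
  have hq : (fun h : ℝ => (2 * b) * h ^ 2) =O[𝓝[>] (0:ℝ)] fun h => h ^ 2 :=
    (isBigO_refl _ _).const_mul_left _
  have e1 : ∀ h : ℝ, x + -1 * h = x - h := fun h => by ring
  have e2 : ∀ h : ℝ, x + -2 * h = x - 2 * h := fun h => by ring
  simp only [e1, e2, one_mul] at p1 m1 m2
  fin_cases k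
  · refine beta_aux (D := fun h => f (x - 2*h) - 2 * f (x - h) + f x)
      (E := fun h => f (x - 2*h) - 4 * f (x - h) + 3 * f x) (c := 2 * deriv f x) (by ring) ?_ ?_
    · exact (((m2.sub (m1.const_mul_left 2)).trans h32).add hq).congr_left fun h => by ring
    · exact (m2.sub (m1.const_mul_left 4)).congr_left fun h => by ring
  · refine beta_aux (D := fun h => f (x - h) - 2 * f x + f (x + h))
      (E := fun h => f (x + h) - f (x - h)) (c := 2 * deriv f x) (by ring) ?_ ?_
    · exact (((m1.add p1).trans h32).add hq).congr_left fun h => by ring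
    · exact (p1.sub m1).congr_left fun h => by ring
  · refine beta_aux (D := fun h => f x - 2 * f (x + h) + f (x + 2*h))
      (E := fun h => 3 * f x - 4 * f (x + h) + f (x + 2*h)) (c := -2 * deriv f x) (by ring) ?_ ?_
    · exact (((p2.sub (p1.const_mul_left 2)).trans h32).add hq).congr_left fun h => by ring
    · exact (p2.sub (p1.const_mul_left 4)).congr_left fun h => by ring

/-- The WENO-JS nonlinear weights (with `p = 2`, `ε = 0`) converge to the linear
weights with second order of accuracy in smooth monotone regions. -/
theorem wenoJS_weights_second_order (f : ℝ → ℝ) (hf : ContDiff ℝ (⊤ : ℕ∞) f) (x : ℝ)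
    (hx : deriv f x ≠ 0)
    (hβ : ∀ k : Fin 3, ∀ᶠ h in 𝓝[>] (0:ℝ), betaJS f x h k ≠ 0) :
    ∀ k : Fin 3,
      (fun h : ℝ =>
          (dlin k / (betaJS f x h k)^2)
            / (∑ l : Fin 3, dlin l / (betaJS f x h l)^2) - dlin k)
        =O[𝓝[>] (0:ℝ)] fun h => h ^ 2 := by
  intro k
  set a := deriv f x with ha
  have ha2 : a ^ 2 ≠ 0 := pow_ne_zero 2 hx
  have hB := betaJS_aux f hf x
  have hsq : Tendsto (fun h : ℝ => h ^ 2) (𝓝[>] (0:ℝ)) (𝓝 0) := by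
    have : Continuous (fun h : ℝ => h ^ 2) := by fun_prop
    have := this.tendsto 0
    simp only [ne_eq, OfNat.ofNat_ne_zero, not_false_eq_true, zero_pow] at this
    exact this.mono_left nhdsWithin_le_nhds
  have hg : ∀ l : Fin 3, (fun h => ((betaJS f x h l / h ^ 2) ^ 2)⁻¹ - ((a ^ 2) ^ 2)⁻¹)
      =O[𝓝[>] (0:ℝ)] fun h => h ^ 2 := by
    intro l
    have hT : Tendsto (fun h => betaJS f x h l / h ^ 2) (𝓝[>] (0:ℝ)) (𝓝 (a ^ 2)) :=
      tendsto_sub_nhds_zero_iff.1 ((hB l).trans_tendsto hsq)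
    have hd : DifferentiableAt ℝ (fun y : ℝ => (y ^ 2)⁻¹) (a ^ 2) :=
      (differentiableAt_id.pow 2).inv (pow_ne_zero 2 ha2)
    exact (hd.isBigO_sub.comp_tendsto hT).trans (hB l)
  have hS : (fun h => (∑ l : Fin 3, dlin l * ((betaJS f x h l / h ^ 2) ^ 2)⁻¹) - ((a ^ 2) ^ 2)⁻¹)
      =O[𝓝[>] (0:ℝ)] fun h => h ^ 2 := by
    have := (((hg 0).const_mul_left (1/10)).add ((hg 1).const_mul_left (6/10))).add
      ((hg 2).const_mul_left (3/10))
    refine this.congr_left fun h => ?_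
    simp only [Fin.sum_univ_three, dlin, Matrix.cons_val]
    ring
  have hST := tendsto_sub_nhds_zero_iff.1 (hS.trans_tendsto hsq)
  have hne : ((a ^ 2) ^ 2)⁻¹ ≠ 0 := inv_ne_zero (pow_ne_zero 2 ha2)
  have hinv := (hST.inv₀ hne).isBigO_one ℝ
  have hfin := ((((hg k).sub hS).const_mul_left (dlin k)).mul hinv)
  refine hfin.congr' ?_ (Eventually.of_forall fun h => by simp)
  filter_upwards [self_mem_nhdsWithin, hST.eventually_ne hne] with h hh hSne
  have h0 : h ≠ 0 := ne_of_gt hh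
  have key : ∀ l : Fin 3, dlin l / (betaJS f x h l) ^ 2
      = (dlin l * ((betaJS f x h l / h ^ 2) ^ 2)⁻¹) * (h ^ 4)⁻¹ := by
    intro l
    rw [div_pow, inv_div, div_eq_mul_inv, div_eq_mul_inv]
    have : (h ^ 2) ^ 2 * (h ^ 4)⁻¹ = 1 := by field_simp
    linear_combination (-(dlin l * (betaJS f x h l ^ 2)⁻¹)) * this
  simp only [key]
  rw [← Finset.sum_mul, mul_div_mul_right _ _ (inv_ne_zero (pow_ne_zero 4 h0))]
  generalize (∑ l, dlin l * ((betaJS f x h l / h ^ 2) ^ 2)⁻¹) = S at hSne ⊢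
  have hS1 : S * S⁻¹ = 1 := mul_inv_cancel₀ hSne
  rw [div_eq_mul_inv _ S]
  linear_combination (-dlin k) * hS1
end
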